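/- If S_{ii} = S̃_{ii} for all i and S_{ij} ≥ S̃_{ij} for all pairs (i,j), then φ(n,1) ≤ φ(n,0) for every n ∈ (0,1]; that is, n^{−1} log E[(Σ_i w_i e^{U_i})^n] ≤ n^{−1} log E[(Σ_i w_i e^{Ũ_i})^n]. -/

import Mathlib

open MeasureTheory ProbabilityTheory Real Filter Topology

noncomputable section

/-- Law of `M` i.i.d. standard Gaussians. -/
def gMu (M : ℕ) : Measure (Fin M → ℝ) := Measure.pi fun _ => gaussianReal 0 1

/-- The centered Gaussian family `U_i = Σ_k A_{ik} g_k`. -/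
def gU {N M : ℕ} (A : Matrix (Fin N) (Fin M) ℝ) (i : Fin N) (g : Fin M → ℝ) : ℝ :=
  ∑ k, A i k * g k

/-- Covariance matrix `S = A Aᵀ`, i.e. `S_{ij} = E[U_i U_j]`. -/
def gS {N M : ℕ} (A : Matrix (Fin N) (Fin M) ℝ) (i j : Fin N) : ℝ :=
  ∑ k, A i k * A j k

/-- Gaussian integration by parts on the real line. -/
theorem integral_mul_gaussianReal_eq_integral_deriv {f f' : ℝ → ℝ}
    (hf : ∀ x, HasDerivAt f (f' x) x) (h0 : Integrable f (gaussianReal 0 1))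
    (h1 : Integrable (fun x => x * f x) (gaussianReal 0 1))
    (h2 : Integrable f' (gaussianReal 0 1)) :
    ∫ x, x * f x ∂gaussianReal 0 1 = ∫ x, f' x ∂gaussianReal 0 1 := by
  have key : ∀ h : ℝ → ℝ, Integrable h (gaussianReal 0 1) →
      Integrable (fun x => gaussianPDFReal 0 1 x * h x) := fun h hh => by
    rw [gaussianReal_of_var_ne_zero 0 one_ne_zero, integrable_withDensity_iff_integrable_smul'
      (measurable_gaussianPDF 0 1) (ae_of_all _ fun _ => gaussianPDF_lt_top)] at hh
    simpa only [toReal_gaussianPDF, smul_eq_mul] using hh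
  have hv : ∀ x, HasDerivAt (gaussianPDFReal 0 1) (-(x * gaussianPDFReal 0 1 x)) x := fun x => by
    have h : HasDerivAt (fun y : ℝ => -y ^ 2 / 2) (-x) x := by
      refine (((hasDerivAt_id x).fun_pow 2).fun_neg.div_const 2).congr_deriv ?_
      simp
      ring
    have hpdf : gaussianPDFReal 0 1 = fun y => (√(2 * π))⁻¹ * rexp (-y ^ 2 / 2) := by
      ext y; simp [gaussianPDFReal_def]
    rw [hpdf]
    exact (h.exp.const_mul _).congr_deriv (by ring)
  have h := integral_mul_deriv_eq_deriv_mul_of_integrable (u := f) (v := gaussianPDFReal 0 1)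
    (u' := f') (v' := fun x => -(x * gaussianPDFReal 0 1 x)) (fun x _ => hf x) (fun x _ => hv x)
    ((key _ h1).neg.congr (ae_of_all _ fun x => by simp; ring))
    ((key _ h2).congr (ae_of_all _ fun x => by simp [mul_comm]))
    ((key _ h0).congr (ae_of_all _ fun x => by simp [mul_comm]))
  rw [integral_gaussianReal_eq_integral_smul one_ne_zero,
    integral_gaussianReal_eq_integral_smul one_ne_zero]
  simp only [mul_neg, integral_neg, neg_inj] at h
  calc _ = ∫ x, f x * (x * gaussianPDFReal 0 1 x) := by congr 1; ext x; simp; ring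
    _ = _ := h
    _ = _ := by congr 1; ext x; simp [mul_comm]

instance {K : ℕ} : IsProbabilityMeasure (gMu K) := by unfold gMu; infer_instance

/-- Gaussian integration by parts in one coordinate of a standard Gaussian vector. -/
theorem integral_coord_mul_gMu_eq_integral_deriv {K : ℕ} (k : Fin K) {H H' : (Fin K → ℝ) → ℝ}
    (hH : ∀ g, HasDerivAt (fun t => H (Function.update g k t)) (H' g) (g k))
    (h0 : Integrable H (gMu K)) (h1 : Integrable (fun g => g k * H g) (gMu K))
    (h2 : Integrable H' (gMu K)) :
    ∫ g, g k * H g ∂gMu K = ∫ g, H' g ∂gMu K := by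
  cases K with
  | zero => exact k.elim0
  | succ m =>
    have hmp := (measurePreserving_piFinSuccAbove (fun _ : Fin (m + 1) => gaussianReal 0 1) k).symm
    have hint : ∀ h : (Fin (m + 1) → ℝ) → ℝ, Integrable h (gMu (m + 1)) →
        Integrable (fun z : ℝ × (Fin m → ℝ) => h (k.insertNth z.1 z.2))
          ((gaussianReal 0 1).prod (gMu m)) := fun h hh =>
      (hmp.integrable_comp_emb (MeasurableEquiv.measurableEmbedding _)).2 hh
    have hval : ∀ h : (Fin (m + 1) → ℝ) → ℝ, Integrable h (gMu (m + 1)) →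
        ∫ g, h g ∂gMu (m + 1) =
          ∫ y, ∫ x, h (k.insertNth x y) ∂gaussianReal 0 1 ∂gMu m := fun h hh =>
      (hmp.integral_comp' h).symm.trans (integral_prod_symm _ (hint h hh))
    rw [hval _ h1, hval _ h2]
    apply integral_congr_ae
    filter_upwards [(hint _ h0).prod_left_ae, (hint _ h1).prod_left_ae,
      (hint _ h2).prod_left_ae] with y i0 i1 i2
    simp only [Fin.insertNth_apply_same] at i1 ⊢
    refine integral_mul_gaussianReal_eq_integral_deriv (fun x => ?_) i0 i1 i2
    simpa using hH (k.insertNth x y)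

theorem integrable_exp_mul_sum_abs (K : ℕ) (c : ℝ) :
    Integrable (fun g : Fin K → ℝ => rexp (c * ∑ k, |g k|)) (gMu K) := by
  have h := Integrable.fintype_prod (μ := fun _ : Fin K => gaussianReal 0 1)
    (f := fun _ x => rexp (c * |x|)) fun _ => integrable_exp_mul_abs
      (integrable_exp_mul_gaussianReal c) (integrable_exp_mul_gaussianReal (-c))
  simpa [gMu, Finset.mul_sum, Real.exp_sum] using h

theorem integral_gMu_comp {K L : ℕ} (e : Fin L → Fin K) (he : Function.Injective e)
    {f : (Fin L → ℝ) → ℝ} (hf : Measurable f) :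
    ∫ g, f (fun i => g (e i)) ∂gMu K = ∫ g, f g ∂gMu L := by
  have hind : iIndepFun (fun (k : Fin K) (g : Fin K → ℝ) => g k) (gMu K) :=
    iIndepFun_pi (X := fun _ x => x) fun _ => aemeasurable_id
  have h := (iIndepFun_iff_map_fun_eq_pi_map (fun i => (measurable_pi_apply (e i)).aemeasurable)).1
    (hind.precomp he)
  have hm : ∀ k : Fin K, (gMu K).map (fun g => g k) = gaussianReal 0 1 := fun k =>
    (measurePreserving_eval (fun _ : Fin K => gaussianReal 0 1) k).map_eq
  simp only [hm] at h
  rw [gMu.eq_1 L, ← h, integral_map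
    (measurable_pi_lambda _ fun i => measurable_pi_apply (e i)).aemeasurable hf.aestronglyMeasurable]

section ExpSum

variable {N : ℕ}

/-- The weighted exponential sum `Z(x) = Σ_i w_i e^{x_i}`. -/
def expSum (w x : Fin N → ℝ) : ℝ := ∑ i, w i * rexp (x i)

/-- The partial derivative `∂_i` of `Z^n`. -/
def powGrad (n : ℝ) (w x : Fin N → ℝ) (i : Fin N) : ℝ :=
  n * expSum w x ^ (n - 1) * (w i * rexp (x i))

/-- The second partial derivative `∂_j ∂_i` of `Z^n`. -/
def powHess (n : ℝ) (w x : Fin N → ℝ) (i j : Fin N) : ℝ :=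
  n * (n - 1) * expSum w x ^ (n - 2) * (w i * rexp (x i)) * (w j * rexp (x j)) +
    if i = j then powGrad n w x i else 0

variable {n : ℝ} {w : Fin N → ℝ}

theorem expSum_pos [Nonempty (Fin N)] (hw : ∀ i, 0 < w i) (x : Fin N → ℝ) : 0 < expSum w x :=
  Finset.sum_pos (fun i _ => mul_pos (hw i) (exp_pos _)) Finset.univ_nonempty

theorem mul_exp_le_expSum (hw : ∀ i, 0 < w i) (x : Fin N → ℝ) (i : Fin N) :
    w i * rexp (x i) ≤ expSum w x :=
  Finset.single_le_sum (f := fun i => w i * rexp (x i))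
    (fun i _ => (mul_pos (hw i) (exp_pos _)).le) (Finset.mem_univ i)

theorem HasDerivAt.expSum {x : ℝ → Fin N → ℝ} {x' : Fin N → ℝ} {t : ℝ}
    (hx : ∀ i, HasDerivAt (fun s => x s i) (x' i) t) :
    HasDerivAt (fun s => expSum w (x s)) (∑ i, w i * rexp (x t i) * x' i) t := by
  unfold _root_.expSum
  exact (HasDerivAt.fun_sum fun i _ => ((hx i).exp.const_mul (w i))).congr_deriv
    (Finset.sum_congr rfl fun i _ => by ring)

theorem hasDerivAt_expSum_rpow [Nonempty (Fin N)] (hw : ∀ i, 0 < w i)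
    {x : ℝ → Fin N → ℝ} {x' : Fin N → ℝ} {t : ℝ}
    (hx : ∀ i, HasDerivAt (fun s => x s i) (x' i) t) :
    HasDerivAt (fun s => expSum w (x s) ^ n) (∑ i, powGrad n w (x t) i * x' i) t := by
  refine ((HasDerivAt.expSum hx).rpow_const (p := n)
    (Or.inl (expSum_pos hw (x t)).ne')).congr_deriv ?_
  simp only [powGrad, Finset.sum_mul]
  exact Finset.sum_congr rfl fun i _ => by ring

theorem hasDerivAt_powGrad [Nonempty (Fin N)] (hw : ∀ i, 0 < w i) (i : Fin N)
    {x : ℝ → Fin N → ℝ} {x' : Fin N → ℝ} {t : ℝ}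
    (hx : ∀ i, HasDerivAt (fun s => x s i) (x' i) t) :
    HasDerivAt (fun s => powGrad n w (x s) i) (∑ j, powHess n w (x t) i j * x' j) t := by
  have h := ((hasDerivAt_expSum_rpow (n := n - 1) hw hx).const_mul n).mul
    ((hx i).exp.const_mul (w i))
  refine h.congr_deriv ?_
  have e : n - 1 - 1 = n - 2 := by ring
  simp only [powHess, add_mul, Finset.sum_add_distrib, ite_mul, zero_mul,
    Finset.sum_ite_eq, Finset.mem_univ, if_true, powGrad, e, Finset.mul_sum, Finset.sum_mul]
  refine congrArg₂ _ (Finset.sum_congr rfl fun j _ => by ring) (by ring)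

theorem abs_powGrad_le [Nonempty (Fin N)] (hw : ∀ i, 0 < w i) (hn : n ∈ Set.Ioc (0 : ℝ) 1)
    (x : Fin N → ℝ) (i : Fin N) : |powGrad n w x i| ≤ expSum w x ^ n := by
  have hZ := expSum_pos hw x
  have hp := mul_pos (hw i) (exp_pos (x i))
  have hd : 0 ≤ expSum w x ^ (n - 1) := (rpow_pos_of_pos hZ _).le
  have e : expSum w x ^ n = 1 * expSum w x ^ (n - 1) * expSum w x := by
    rw [one_mul, ← rpow_add_one hZ.ne', sub_add_cancel]
  rw [powGrad, abs_of_nonneg (by have := hn.1; positivity), e]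
  have := hn.2
  gcongr
  exact mul_exp_le_expSum hw x i

theorem abs_powHess_le [Nonempty (Fin N)] (hw : ∀ i, 0 < w i) (hn : n ∈ Set.Ioc (0 : ℝ) 1)
    (x : Fin N → ℝ) (i j : Fin N) : |powHess n w x i j| ≤ 2 * expSum w x ^ n := by
  have hZ := expSum_pos hw x
  have hp := fun i => (mul_pos (hw i) (exp_pos (x i))).le
  have hd : 0 ≤ expSum w x ^ (n - 2) := (rpow_pos_of_pos hZ _).le
  have e : expSum w x ^ n = 1 * expSum w x ^ (n - 2) * expSum w x * expSum w x := by
    rw [one_mul, mul_assoc, ← sq, ← rpow_natCast, ← rpow_add hZ]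
    norm_num
  have hn' : |n * (n - 1)| ≤ 1 := by
    rw [abs_le]
    constructor <;> nlinarith [hn.1, hn.2]
  have h1 : |n * (n - 1) * expSum w x ^ (n - 2) * (w i * rexp (x i)) * (w j * rexp (x j))| ≤
      expSum w x ^ n := by
    rw [abs_mul, abs_mul, abs_mul, abs_of_nonneg hd, abs_of_nonneg (hp i), abs_of_nonneg (hp j), e]
    have hi := hp i
    have hj := hp j
    gcongr
    · exact mul_exp_le_expSum hw x i
    · exact mul_exp_le_expSum hw x j
  have h2 : |if i = j then powGrad n w x i else 0| ≤ expSum w x ^ n := by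
    split_ifs
    · exact abs_powGrad_le hw hn x i
    · simpa using (rpow_pos_of_pos hZ n).le
  exact (abs_add_le _ _).trans (by linarith)

theorem powHess_nonpos_of_ne [Nonempty (Fin N)] (hw : ∀ i, 0 < w i) (hn : n ∈ Set.Ioc (0 : ℝ) 1)
    (x : Fin N → ℝ) {i j : Fin N} (hij : i ≠ j) : powHess n w x i j ≤ 0 := by
  have hZ := rpow_pos_of_pos (expSum_pos hw x) (n - 2)
  have hi := mul_pos (hw i) (exp_pos (x i))
  have hj := mul_pos (hw j) (exp_pos (x j))
  rw [powHess, if_neg hij, add_zero, mul_assoc, mul_assoc]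
  exact mul_nonpos_of_nonpos_of_nonneg
    (mul_nonpos_of_nonneg_of_nonpos hn.1.le (by linarith [hn.2])) (by positivity)

theorem measurable_expSum (w : Fin N → ℝ) : Measurable (expSum w) := by
  unfold expSum
  fun_prop

theorem measurable_powGrad (n : ℝ) (w : Fin N → ℝ) (i : Fin N) :
    Measurable fun x => powGrad n w x i := by
  have := measurable_expSum w
  unfold powGrad
  fun_prop

theorem measurable_powHess (n : ℝ) (w : Fin N → ℝ) (i j : Fin N) :
    Measurable fun x => powHess n w x i j := by
  have := measurable_expSum w
  have := measurable_powGrad n w i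
  unfold powHess
  split_ifs <;> fun_prop

end ExpSum

section Interpolation

variable {N K : ℕ} {n C : ℝ} {w : Fin N → ℝ}

/-- An integrable majorant for `Z^n` and its first moments under matrices with entries bounded
by `C`. -/
def majorant (w : Fin N → ℝ) (C : ℝ) (g : Fin K → ℝ) : ℝ :=
  (1 + ∑ i, w i) * rexp ((C + 1) * ∑ k, |g k|)

theorem integrable_majorant (w : Fin N → ℝ) (C : ℝ) :
    Integrable (majorant w C) (gMu K) :=
  (integrable_exp_mul_sum_abs K (C + 1)).const_mul _

theorem measurable_gU (A : Matrix (Fin N) (Fin K) ℝ) : Measurable fun g i => gU A i g := by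
  unfold gU
  fun_prop

theorem one_add_mul_expSum_gU_rpow_le_majorant [Nonempty (Fin N)] (hw : ∀ i, 0 < w i)
    (hn : n ∈ Set.Ioc (0 : ℝ) 1) (hC : 0 ≤ C) {B : Matrix (Fin N) (Fin K) ℝ}
    (hB : ∀ i k, |B i k| ≤ C) (g : Fin K → ℝ) :
    (1 + ∑ k, |g k|) * expSum w (fun i => gU B i g) ^ n ≤ majorant w C g := by
  set T := ∑ k, |g k|
  have hT : 0 ≤ T := Finset.sum_nonneg fun _ _ => abs_nonneg _
  have hZ := expSum_pos hw fun i => gU B i g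
  have hx : ∀ i, gU B i g ≤ C * T := fun i => by
    rw [gU, Finset.mul_sum]
    refine Finset.sum_le_sum fun k _ => (le_abs_self _).trans ?_
    rw [abs_mul]
    gcongr
    exact hB i k
  have hZle : expSum w (fun i => gU B i g) ≤ (∑ i, w i) * rexp (C * T) := by
    rw [expSum, Finset.sum_mul]
    exact Finset.sum_le_sum fun i _ =>
      mul_le_mul_of_nonneg_left (exp_le_exp.2 (hx i)) (hw i).le
  have hpow : expSum w (fun i => gU B i g) ^ n ≤ 1 + expSum w (fun i => gU B i g) := by
    rcases le_total (expSum w fun i => gU B i g) 1 with h | h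
    · exact (rpow_le_one hZ.le h hn.1.le).trans (by linarith)
    · exact (rpow_le_rpow_of_exponent_le h hn.2).trans (by rw [rpow_one]; linarith)
  have hone : 1 ≤ rexp (C * T) := one_le_exp (by positivity)
  have hexp : 1 + T ≤ rexp T := by linarith [add_one_le_exp T]
  calc (1 + T) * expSum w (fun i => gU B i g) ^ n
      ≤ rexp T * ((1 + ∑ i, w i) * rexp (C * T)) := by
        gcongr
        linarith
    _ = majorant w C g := by
        rw [majorant, add_mul C, one_mul, exp_add]
        ring

theorem expSum_gU_rpow_le_majorant [Nonempty (Fin N)] (hw : ∀ i, 0 < w i)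
    (hn : n ∈ Set.Ioc (0 : ℝ) 1) (hC : 0 ≤ C) {B : Matrix (Fin N) (Fin K) ℝ}
    (hB : ∀ i k, |B i k| ≤ C) (g : Fin K → ℝ) :
    expSum w (fun i => gU B i g) ^ n ≤ majorant w C g := by
  have hT : 0 ≤ ∑ k, |g k| := Finset.sum_nonneg fun _ _ => abs_nonneg _
  have hZ := rpow_pos_of_pos (expSum_pos hw fun i => gU B i g) n
  exact le_trans (by nlinarith) (one_add_mul_expSum_gU_rpow_le_majorant hw hn hC hB g)

theorem measurable_expSum_gU_rpow (n : ℝ) (w : Fin N → ℝ) (B : Matrix (Fin N) (Fin K) ℝ) :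
    Measurable fun g => expSum w (fun i => gU B i g) ^ n :=
  ((measurable_expSum w).comp (measurable_gU B)).pow_const n

theorem integrable_expSum_gU_rpow [Nonempty (Fin N)] (hw : ∀ i, 0 < w i)
    (hn : n ∈ Set.Ioc (0 : ℝ) 1) (hC : 0 ≤ C) {B : Matrix (Fin N) (Fin K) ℝ}
    (hB : ∀ i k, |B i k| ≤ C) :
    Integrable (fun g => expSum w (fun i => gU B i g) ^ n) (gMu K) :=
  (integrable_majorant w C).mono' (measurable_expSum_gU_rpow n w B).aestronglyMeasurable
    (ae_of_all _ fun g => by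
      rw [Real.norm_of_nonneg (rpow_pos_of_pos (expSum_pos hw _) n).le]
      exact expSum_gU_rpow_le_majorant hw hn hC hB g)

theorem abs_entry_le_sum_abs (A : Matrix (Fin N) (Fin K) ℝ) (i : Fin N) (k : Fin K) :
    |A i k| ≤ ∑ i, ∑ k, |A i k| :=
  (Finset.single_le_sum (f := fun k => |A i k|) (fun _ _ => abs_nonneg _)
    (Finset.mem_univ k)).trans (Finset.single_le_sum (f := fun i => ∑ k, |A i k|)
      (fun _ _ => Finset.sum_nonneg fun _ _ => abs_nonneg _) (Finset.mem_univ i))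

theorem integral_expSum_gU_rpow_pos [Nonempty (Fin N)] (hw : ∀ i, 0 < w i)
    (hn : n ∈ Set.Ioc (0 : ℝ) 1) (B : Matrix (Fin N) (Fin K) ℝ) :
    0 < ∫ g, expSum w (fun i => gU B i g) ^ n ∂gMu K := by
  have hpos := fun g => rpow_pos_of_pos (expSum_pos hw fun i => gU B i g) n
  rw [integral_pos_iff_support_of_nonneg (fun g => (hpos g).le)
    (integrable_expSum_gU_rpow hw hn (by positivity) (abs_entry_le_sum_abs B)),
    Function.support_eq_univ fun g => (hpos g).ne', measure_univ]
  exact zero_lt_one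

/-- Derivative of the Gaussian expectation of `Z^n` along a differentiable path of matrices. -/
theorem hasDerivAt_integral_expSum_rpow [Nonempty (Fin N)] (hw : ∀ i, 0 < w i)
    (hn : n ∈ Set.Ioc (0 : ℝ) 1) (hC : 0 ≤ C) {B B' : ℝ → Matrix (Fin N) (Fin K) ℝ}
    (hB : ∀ t i k, |B t i k| ≤ C) (hB' : ∀ t i k, |B' t i k| ≤ C)
    (hd : ∀ t i k, HasDerivAt (fun s => B s i k) (B' t i k) t) (t : ℝ) :
    HasDerivAt (fun s => ∫ g, expSum w (fun i => gU (B s) i g) ^ n ∂gMu K)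
      (∑ i, ∑ j, (∑ k, B' t i k * B t j k) *
        ∫ g, powHess n w (fun i => gU (B t) i g) i j ∂gMu K) t := by
  have hZ := fun s (g : Fin K → ℝ) =>
    (rpow_pos_of_pos (expSum_pos hw fun i => gU (B s) i g) n).le
  have hT := fun g : Fin K → ℝ =>
    (Finset.sum_nonneg fun k _ => abs_nonneg (g k) : 0 ≤ ∑ k, |g k|)
  have hmaj := fun s => one_add_mul_expSum_gU_rpow_le_majorant hw hn hC (hB s)
  have hpow_le := fun s => expSum_gU_rpow_le_majorant hw hn hC (hB s)
  have hTpow_le : ∀ s g, (∑ k, |g k|) * expSum w (fun i => gU (B s) i g) ^ n ≤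
      majorant w C g := fun s g => le_trans (by nlinarith [hT g, hZ s g]) (hmaj s g)
  have hgrad_meas : ∀ s i, Measurable fun g => powGrad n w (fun i => gU (B s) i g) i :=
    fun s i => (measurable_powGrad n w i).comp (measurable_gU (B s))
  have hhess_meas : ∀ s i j, Measurable fun g => powHess n w (fun i => gU (B s) i g) i j :=
    fun s i j => (measurable_powHess n w i j).comp (measurable_gU (B s))
  have hgrad_int : ∀ i, Integrable (fun g => powGrad n w (fun i => gU (B t) i g) i) (gMu K) :=
    fun i => (integrable_majorant w C).mono' (hgrad_meas t i).aestronglyMeasurable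
      (ae_of_all _ fun g => (abs_powGrad_le hw hn _ i).trans (hpow_le t g))
  have hgrad_int' : ∀ i k, Integrable
      (fun g => g k * powGrad n w (fun i => gU (B t) i g) i) (gMu K) := fun i k =>
    (integrable_majorant w C).mono'
      ((measurable_pi_apply k).mul (hgrad_meas t i)).aestronglyMeasurable
      (ae_of_all _ fun g => by
        rw [norm_mul]
        exact (mul_le_mul (Finset.single_le_sum (f := fun k => |g k|)
          (fun _ _ => abs_nonneg _) (Finset.mem_univ k)) (abs_powGrad_le hw hn _ i)
          (abs_nonneg _) (hT g)).trans (hTpow_le t g))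
  have hhess_int : ∀ i j, Integrable (fun g => powHess n w (fun i => gU (B t) i g) i j) (gMu K) :=
    fun i j => ((integrable_majorant w C).const_mul 2).mono'
      (hhess_meas t i j).aestronglyMeasurable
      (ae_of_all _ fun g => (abs_powHess_le hw hn _ i j).trans
        (mul_le_mul_of_nonneg_left (hpow_le t g) zero_le_two))
  have hgU_deriv : ∀ s g i, HasDerivAt (fun s => gU (B s) i g) (gU (B' s) i g) s :=
    fun s g i => by
      unfold gU
      exact HasDerivAt.fun_sum fun k _ => (hd s i k).mul_const (g k)
  have hgU_coord : ∀ (g : Fin K → ℝ) k i,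
      HasDerivAt (fun r => gU (B t) i (Function.update g k r)) (B t i k) (g k) := fun g k i => by
    have h : ∀ l, HasDerivAt (fun r => B t i l * Function.update g k r l)
        (if l = k then B t i l else 0) (g k) := fun l => by
      split_ifs with hl
      · subst hl
        simpa using (hasDerivAt_id (g l)).const_mul (B t i l)
      · simpa [Function.update_of_ne hl] using hasDerivAt_const (g k) (B t i l * g l)
    unfold gU
    simpa using HasDerivAt.fun_sum fun l (_ : l ∈ Finset.univ) => h l
  have hparts : ∀ i k, ∫ g, g k * powGrad n w (fun i => gU (B t) i g) i ∂gMu K =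
      ∑ j, B t j k * ∫ g, powHess n w (fun i => gU (B t) i g) i j ∂gMu K := fun i k => by
    have h := integral_coord_mul_gMu_eq_integral_deriv k
      (H' := fun g => ∑ j, powHess n w (fun i => gU (B t) i g) i j * B t j k)
      (fun g => by
        simpa using hasDerivAt_powGrad (n := n) hw i (hgU_coord g k))
      (hgrad_int i) (hgrad_int' i k)
      (integrable_finsetSum _ fun j _ => (hhess_int i j).mul_const _)
    rw [h, integral_finsetSum _ fun j _ => (hhess_int i j).mul_const _]
    exact Finset.sum_congr rfl fun j _ => by rw [integral_mul_const, mul_comm]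
  have hsum : ∀ g : Fin K → ℝ, ∑ i, powGrad n w (fun i => gU (B t) i g) i * gU (B' t) i g =
      ∑ i, ∑ k, B' t i k * (g k * powGrad n w (fun i => gU (B t) i g) i) := fun g => by
    simp only [gU, Finset.mul_sum]
    exact Finset.sum_congr rfl fun i _ => Finset.sum_congr rfl fun k _ => by ring
  have hbound : ∀ s g, ‖∑ i, powGrad n w (fun i => gU (B s) i g) i * gU (B' s) i g‖ ≤
      ∑ _i : Fin N, C * majorant w C g := fun s g => by
    refine norm_sum_le_of_le _ fun i _ => ?_
    have h1 : |gU (B' s) i g| ≤ C * ∑ k, |g k| := by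
      rw [gU, Finset.mul_sum]
      refine (Finset.abs_sum_le_sum_abs _ _).trans (Finset.sum_le_sum fun k _ => ?_)
      rw [abs_mul]
      exact mul_le_mul_of_nonneg_right (hB' s i k) (abs_nonneg _)
    rw [norm_mul]
    calc _ ≤ expSum w (fun i => gU (B s) i g) ^ n * (C * ∑ k, |g k|) :=
          mul_le_mul (abs_powGrad_le hw hn _ i) h1 (abs_nonneg _) (hZ s g)
      _ = C * ((∑ k, |g k|) * expSum w (fun i => gU (B s) i g) ^ n) := by ring
      _ ≤ _ := mul_le_mul_of_nonneg_left (hTpow_le s g) hC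
  have hmain := (hasDerivAt_integral_of_dominated_loc_of_deriv_le (μ := gMu K)
    (F := fun s g => expSum w (fun i => gU (B s) i g) ^ n)
    (F' := fun s g => ∑ i, powGrad n w (fun i => gU (B s) i g) i * gU (B' s) i g)
    (x₀ := t) univ_mem (Eventually.of_forall fun s =>
      (measurable_expSum_gU_rpow n w (B s)).aestronglyMeasurable)
    (integrable_expSum_gU_rpow hw hn hC (hB t))
    (Finset.measurable_sum _ fun i _ => (hgrad_meas t i).mul
      ((measurable_pi_apply i).comp (measurable_gU (B' t)))).aestronglyMeasurable
    (ae_of_all _ fun g s _ => hbound s g)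
    (integrable_finsetSum _ fun _ _ => (integrable_majorant w C).const_mul C)
    (ae_of_all _ fun g s _ => hasDerivAt_expSum_rpow hw (hgU_deriv s g))).2
  refine hmain.congr_deriv ?_
  simp only [hsum]
  refine (integral_finsetSum _ fun i _ => integrable_finsetSum _ fun k _ =>
    (hgrad_int' i k).const_mul (B' t i k)).trans ?_
  refine Finset.sum_congr rfl fun i _ => ?_
  refine (integral_finsetSum _ fun k _ => (hgrad_int' i k).const_mul (B' t i k)).trans ?_
  simp only [integral_const_mul, hparts, Finset.mul_sum, Finset.sum_mul]
  rw [Finset.sum_comm]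
  exact Finset.sum_congr rfl fun j _ => Finset.sum_congr rfl fun k _ => by ring

end Interpolation

/-- Comparison of the Gaussian expectations of `Z^n` for ordered covariances with equal
diagonals. -/
theorem integral_expSum_rpow_le {N M M' : ℕ} [Nonempty (Fin N)] {n : ℝ} {w : Fin N → ℝ}
    (hw : ∀ i, 0 < w i) (hn : n ∈ Set.Ioc (0 : ℝ) 1)
    (A : Matrix (Fin N) (Fin M) ℝ) (A' : Matrix (Fin N) (Fin M') ℝ)
    (hdiag : ∀ i, gS A i i = gS A' i i) (hoff : ∀ i j, gS A' i j ≤ gS A i j) :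
    ∫ g, expSum w (fun i => gU A i g) ^ n ∂gMu M ≤
      ∫ g, expSum w (fun i => gU A' i g) ^ n ∂gMu M' := by
  let B : ℝ → Matrix (Fin N) (Fin (M + M')) ℝ := fun t i =>
    Fin.append (fun k => sin t * A i k) (fun k => cos t * A' i k)
  let B' : ℝ → Matrix (Fin N) (Fin (M + M')) ℝ := fun t i =>
    Fin.append (fun k => cos t * A i k) (fun k => -sin t * A' i k)
  let C : ℝ := (∑ i, ∑ k, |A i k|) + ∑ i, ∑ k, |A' i k|
  have hAC : ∀ i k, |A i k| ≤ C := fun i k =>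
    (abs_entry_le_sum_abs A i k).trans (le_add_of_nonneg_right (by positivity))
  have hAC' : ∀ i k, |A' i k| ≤ C := fun i k =>
    (abs_entry_le_sum_abs A' i k).trans (le_add_of_nonneg_left (by positivity))
  have hmul : ∀ {a b : ℝ}, |a| ≤ 1 → |b| ≤ C → |a * b| ≤ C := fun {a b} ha hb => by
    rw [abs_mul]
    exact (mul_le_of_le_one_left (abs_nonneg b) ha).trans hb
  have hder := hasDerivAt_integral_expSum_rpow (B := B) (B' := B') hw hn
    (C := C) (by positivity)
    (fun t i k => by
      refine Fin.addCases (fun k => ?_) (fun k => ?_) k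
      · simpa [B] using hmul (abs_sin_le_one t) (hAC i k)
      · simpa [B] using hmul (abs_cos_le_one t) (hAC' i k))
    (fun t i k => by
      refine Fin.addCases (fun k => ?_) (fun k => ?_) k
      · simpa [B'] using hmul (abs_cos_le_one t) (hAC i k)
      · simpa [B'] using hmul (abs_sin_le_one t) (hAC' i k))
    (fun t i k => by
      refine Fin.addCases (fun k => ?_) (fun k => ?_) k
      · simpa [B, B'] using (hasDerivAt_sin t).mul_const (A i k)
      · simpa [B, B'] using (hasDerivAt_cos t).mul_const (A' i k))
  have hcov : ∀ t i j, ∑ k, B' t i k * B t j k =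
      sin t * cos t * (gS A i j - gS A' i j) := fun t i j => by
    simp only [B, B', gS, Fin.sum_univ_add, Fin.append_left, Fin.append_right,
      ← Finset.sum_neg_distrib, sub_eq_add_neg, mul_add, Finset.mul_sum]
    exact congrArg₂ _ (Finset.sum_congr rfl fun k _ => by ring)
      (Finset.sum_congr rfl fun k _ => by ring)
  have hanti := antitoneOn_of_deriv_nonpos (convex_Icc 0 (π / 2))
    (fun t _ => (hder t).continuousAt.continuousWithinAt)
    (fun t _ => (hder t).differentiableAt.differentiableWithinAt)
    (fun t ht => by
      rw [interior_Icc] at ht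
      have hs : 0 ≤ sin t := sin_nonneg_of_nonneg_of_le_pi ht.1.le (by linarith [ht.2, pi_pos])
      have hc : 0 ≤ cos t := cos_nonneg_of_mem_Icc ⟨by linarith [ht.1, pi_pos], ht.2.le⟩
      rw [(hder t).deriv]
      refine Finset.sum_nonpos fun i _ => Finset.sum_nonpos fun j _ => ?_
      rw [hcov]
      rcases eq_or_ne i j with rfl | hij
      · simp [hdiag i]
      · exact mul_nonpos_of_nonneg_of_nonpos
          (mul_nonneg (mul_nonneg hs hc) (sub_nonneg.2 (hoff i j)))
          (integral_nonpos fun g => powHess_nonpos_of_ne hw hn _ hij))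
  have h := hanti (Set.left_mem_Icc.2 (by positivity)) (Set.right_mem_Icc.2 (by positivity))
    (by positivity : (0 : ℝ) ≤ π / 2)
  have hend : ∀ g i, gU (B (π / 2)) i g = gU A i fun k => g (Fin.castAdd M' k) := fun g i => by
    simp [gU, B, Fin.sum_univ_add]
  have hstart : ∀ g i, gU (B 0) i g = gU A' i fun k => g (Fin.natAdd M k) := fun g i => by
    simp [gU, B, Fin.sum_univ_add]
  simp only [hend, hstart] at h
  rwa [integral_gMu_comp (Fin.castAdd M') (Fin.castAdd_injective M M')
      (f := fun g => expSum w (fun i => gU A i g) ^ n)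
      (measurable_expSum_gU_rpow n w A),
    integral_gMu_comp (Fin.natAdd M) (Fin.natAdd_injective M' M)
      (f := fun g => expSum w (fun i => gU A' i g) ^ n)
      (measurable_expSum_gU_rpow n w A')] at h

/-- if `S_{ii} = S̃_{ii}` for all `i` and `S_{ij} ≥ S̃_{ij}` for all pairs,
then `φ(n,1) ≤ φ(n,0)` for every `n ∈ (0,1]`, i.e.
`n⁻¹ log E[(Σ_i w_i e^{U_i})^n] ≤ n⁻¹ log E[(Σ_i w_i e^{Ũ_i})^n]`. -/
theorem stmt4 {N M M' : ℕ} (hN : 1 ≤ N) (hM : 1 ≤ M) (hM' : 1 ≤ M')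
    (w : Fin N → ℝ) (hw : ∀ i, 0 < w i)
    (A : Matrix (Fin N) (Fin M) ℝ) (A' : Matrix (Fin N) (Fin M') ℝ)
    (hdiag : ∀ i, gS A i i = gS A' i i)
    (hoff : ∀ i j, gS A' i j ≤ gS A i j)
    (n : ℝ) (hn : n ∈ Set.Ioc (0:ℝ) 1) :
    n⁻¹ * Real.log (∫ g, (∑ i, w i * Real.exp (gU A i g)) ^ n ∂ gMu M) ≤
      n⁻¹ * Real.log (∫ g, (∑ i, w i * Real.exp (gU A' i g)) ^ n ∂ gMu M') := by
  have : Nonempty (Fin N) := ⟨⟨0, hN⟩⟩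
  refine mul_le_mul_of_nonneg_left (Real.log_le_log ?_ ?_) (inv_nonneg.2 hn.1.le)
  · exact integral_expSum_gU_rpow_pos hw hn A
  · exact integral_expSum_rpow_le hw hn A A' hdiag hoff
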